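/- For every dimension d ≥ 1, r^SS(3) = 6; that is, 6 is the smallest natural number r such that the Softmax–Softmax polynomial system of order r with m = 3 blocks admits no non-trivial solution. -/

import Mathlib

/-!
Softmax–Softmax polynomial system: for every dimension `d ≥ 1`, `r^SS(3) = 6`,
i.e. 4 is the smallest natural number `r` such that the system of order `r`
with `m = 3` blocks admits no non-trivial solution.
-/

noncomputable section

/-- Multi-index `v ^ α := ∏ j, v j ^ α j`. -/
def mpow {d : ℕ} (v : Fin d → ℝ) (α : Fin d → ℕ) : ℝ := ∏ j, v j ^ α j

/-- Multi-index factorial `α! := ∏ j, (α j)!`. -/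
def mfact {d : ℕ} (α : Fin d → ℕ) : ℕ := ∏ j, Nat.factorial (α j)

/-- Multi-index degree `|α| := ∑ j, α j`. -/
def mdeg {d : ℕ} (α : Fin d → ℕ) : ℕ := ∑ j, α j

/-- A finite box containing every multi-index `α ≤ ρ` (coordinatewise). -/
def mIdxBox {d : ℕ} (ρ : Fin d → ℕ) : Finset (Fin d → ℕ) :=
  Fintype.piFinset fun j => Finset.range (ρ j + 1)

/-- Left-hand side of the Softmax–Softmax polynomial equation indexed by `(ρ₁, ρ₂)`:
`∑ i ∑_{α₁+α₂+α₃=ρ₁, |α₃|+α₄+2α₅=ρ₂} p_i² q_{1i}^{α₁} q₂^{α₂} q_{3i}^{α₃} q_{4i}^{α₄} q_{5i}^{α₅}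
  / (α₁! α₂! α₃! α₄! α₅!)`. -/
def ssLHS {m d : ℕ} (p : Fin m → ℝ) (q1 : Fin m → Fin d → ℝ) (q2 : Fin d → ℝ)
    (q3 : Fin m → Fin d → ℝ) (q4 q5 : Fin m → ℝ) (ρ1 : Fin d → ℕ) (ρ2 : ℕ) : ℝ :=
  ∑ i : Fin m, ∑ α1 ∈ mIdxBox ρ1, ∑ α2 ∈ mIdxBox ρ1, ∑ α3 ∈ mIdxBox ρ1,
    ∑ α4 ∈ Finset.range (ρ2 + 1), ∑ α5 ∈ Finset.range (ρ2 + 1),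
      if α1 + α2 + α3 = ρ1 ∧ mdeg α3 + α4 + 2 * α5 = ρ2 then
        (1 / ((mfact α1 : ℝ) * (mfact α2 : ℝ) * (mfact α3 : ℝ) *
            (Nat.factorial α4 : ℝ) * (Nat.factorial α5 : ℝ))) *
          p i ^ 2 * mpow (q1 i) α1 * mpow q2 α2 * mpow (q3 i) α3 *
          q4 i ^ α4 * q5 i ^ α5
      else 0

/-- The Softmax–Softmax system of order `r` (with `m` blocks, in dimension `d`)
admits a non-trivial solution: all `p_i ≠ 0`, some `q_{4i} ≠ 0`, and every equation
indexed by `(ρ₁, ρ₂)` with `1 ≤ |ρ₁| + ρ₂ ≤ r` holds. -/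
def ssHasNontrivial (m d r : ℕ) : Prop :=
  ∃ (p : Fin m → ℝ) (q1 : Fin m → Fin d → ℝ) (q2 : Fin d → ℝ)
    (q3 : Fin m → Fin d → ℝ) (q4 q5 : Fin m → ℝ),
      (∀ i, p i ≠ 0) ∧ (∃ i, q4 i ≠ 0) ∧
      ∀ (ρ1 : Fin d → ℕ) (ρ2 : ℕ), 1 ≤ mdeg ρ1 + ρ2 → mdeg ρ1 + ρ2 ≤ r →
        ssLHS p q1 q2 q3 q4 q5 ρ1 ρ2 = 0

open Polynomial in
/-- The operator `X + 2 b D` on real polynomials. -/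
def heatOp (b : ℝ) : Module.End ℝ ℝ[X] :=
  LinearMap.mulLeft ℝ (X : ℝ[X]) + (2 * b) • (Polynomial.derivative : ℝ[X] →ₗ[ℝ] ℝ[X])

open Polynomial in
/-- The heat flow `exp (b D²)` on real polynomials. -/
def heat (b : ℝ) : ℝ[X] →ₗ[ℝ] ℝ[X] :=
  (LinearMap.applyₗ (1 : ℝ[X])) ∘ₗ (Polynomial.aeval (heatOp b)).toLinearMap

section heatLemmas
open Polynomial

theorem heatOp_apply (b : ℝ) (P : ℝ[X]) :
    heatOp b P = X * P + C (2 * b) * derivative P := by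
  simp [heatOp, Polynomial.smul_eq_C_mul]

theorem heat_one (b : ℝ) : heat b 1 = 1 := by simp [heat]

theorem heat_C (b c : ℝ) : heat b (C c) = C c := by
  have : (C c : ℝ[X]) = c • 1 := by simp [Polynomial.smul_eq_C_mul]
  rw [this, map_smul, heat_one]

theorem heat_C_mul (b c : ℝ) (P : ℝ[X]) : heat b (C c * P) = C c * heat b P := by
  rw [← Polynomial.smul_eq_C_mul, map_smul, Polynomial.smul_eq_C_mul]

theorem heat_X_mul (b : ℝ) (P : ℝ[X]) :
    heat b (X * P) = X * heat b P + C (2 * b) * derivative (heat b P) := by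
  rw [← heatOp_apply]
  simp [heat]

theorem poly_ind {M : ℝ[X] → Prop} (P : ℝ[X]) (h1 : ∀ c, M (C c))
    (hadd : ∀ p q, M p → M q → M (p + q)) (hX : ∀ p, M p → M (X * p)) : M P := by
  induction P using Polynomial.induction_on with
  | C a => exact h1 a
  | add p q hp hq => exact hadd p q hp hq
  | monomial n a h =>
    have : (C a * X ^ (n + 1) : ℝ[X]) = X * (C a * X ^ n) := by ring
    rw [this]; exact hX _ h

theorem heat_derivative (b : ℝ) (P : ℝ[X]) :
    heat b (derivative P) = derivative (heat b P) := by
  induction P using poly_ind with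
  | h1 c => simp [heat_C]
  | hadd p q hp hq => simp [hp, hq]
  | hX p hp =>
    rw [heat_X_mul, derivative_mul, derivative_X, one_mul, map_add, heat_X_mul, hp]
    simp only [derivative_add, derivative_mul, derivative_X, derivative_C]
    ring

theorem heat_heat (b c : ℝ) (P : ℝ[X]) : heat c (heat b P) = heat (b + c) P := by
  induction P using poly_ind with
  | h1 c => simp [heat_C]
  | hadd p q hp hq => simp [hp, hq]
  | hX p hp =>
    rw [heat_X_mul, map_add, heat_X_mul, heat_C_mul, heat_derivative, heat_X_mul, hp]
    have : (C (2 * (b + c)) : ℝ[X]) = C (2 * b) + C (2 * c) := by rw [← C_add]; congr 1; ring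
    rw [this]; ring

theorem heat_zero (P : ℝ[X]) : heat 0 P = P := by
  induction P using poly_ind with
  | h1 c => simp [heat_C]
  | hadd p q hp hq => simp [hp, hq]
  | hX p hp => rw [heat_X_mul, hp]; simp

theorem heat_ne_zero (b : ℝ) {P : ℝ[X]} (hP : P ≠ 0) : heat b P ≠ 0 := by
  intro h
  apply hP
  have := heat_heat b (-b) P
  rw [h, add_neg_cancel, heat_zero, map_zero] at this
  exact this.symm

theorem heat_natDegree_pow (b : ℝ) (n : ℕ) : (heat b (X ^ n)).natDegree ≤ n := by
  induction n with
  | zero => simp [heat_one]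
  | succ n ih =>
    rw [pow_succ', heat_X_mul]
    refine natDegree_add_le_of_degree_le ?_ ?_
    · refine natDegree_mul_le.trans ?_
      rw [natDegree_X]; omega
    · refine (natDegree_C_mul_le _ _).trans ((natDegree_derivative_le _).trans ?_)
      omega

theorem heat_natDegree (b : ℝ) (N : ℕ) (P : ℝ[X]) (h : P.natDegree ≤ N) :
    (heat b P).natDegree ≤ N := by
  rw [P.as_sum_range_C_mul_X_pow, map_sum]
  refine natDegree_sum_le_of_forall_le _ _ ?_
  intro i hi
  rw [heat_C_mul]
  refine (natDegree_C_mul_le _ _).trans ((heat_natDegree_pow b i).trans ?_)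
  have := Finset.mem_range.1 hi
  omega

/-- `Q` changes sign at least `k` times. -/
def Alt (Q : ℝ[X]) (k : ℕ) : Prop :=
  ∃ (x : ℕ → ℝ) (e : ℝ), (∀ i < k, x i < x (i + 1)) ∧ ∀ i ≤ k, 0 < e * (-1) ^ i * Q.eval (x i)

theorem Alt.mono {Q : ℝ[X]} {k l : ℕ} (h : Alt Q k) (hl : l ≤ k) : Alt Q l := by
  obtain ⟨x, e, h1, h2⟩ := h
  exact ⟨x, e, fun i hi => h1 i (by omega), fun i hi => h2 i (by omega)⟩

theorem Alt.ne_zero {Q : ℝ[X]} {k : ℕ} (h : Alt Q k) : Q ≠ 0 := by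
  obtain ⟨x, e, h1, h2⟩ := h
  rintro rfl
  simpa using h2 0 (Nat.zero_le _)

theorem alt_zero {Q : ℝ[X]} (h : Q ≠ 0) : Alt Q 0 := by
  obtain ⟨a, ha⟩ : ∃ a, Q.eval a ≠ 0 := by
    by_contra! hc
    exact h (Polynomial.funext (by simpa using hc))
  refine ⟨fun _ => a, Q.eval a, by simp, ?_⟩
  intro i hi
  obtain rfl : i = 0 := by omega
  simpa using mul_self_pos.2 ha

theorem Alt.card_roots {Q : ℝ[X]} {k : ℕ} (h : Alt Q k) : k ≤ Q.roots.card := by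
  have hQ := h.ne_zero
  obtain ⟨x, e, h1, h2⟩ := h
  have key : ∀ i, ∃ y, i < k → x i < y ∧ y < x (i + 1) ∧ Q.eval y = 0 := by
    intro i
    by_cases hi : i < k
    swap
    · exact ⟨0, fun h => absurd h hi⟩
    have a1 := h2 i (by omega)
    have a2 := h2 (i + 1) (by omega)
    have hlt := h1 i hi
    have hc : ContinuousOn (fun y => -(e * (-1) ^ i * Q.eval y)) (Set.Icc (x i) (x (i + 1))) := by
      fun_prop
    have := intermediate_value_Ioo hlt.le hc
    have hz : (0 : ℝ) ∈ Set.Ioo (-(e * (-1) ^ i * Q.eval (x i)))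
        (-(e * (-1) ^ i * Q.eval (x (i + 1)))) := by
      rw [pow_succ] at a2
      constructor <;> linarith
    obtain ⟨y, hy, hy0⟩ := this hz
    refine ⟨y, fun _ => ⟨hy.1, hy.2, ?_⟩⟩
    have hne : e * (-1) ^ i ≠ 0 := by
      intro h0
      rw [h0] at a1
      simp at a1
    have : e * (-1) ^ i * Q.eval y = 0 := by simpa using hy0
    exact (mul_eq_zero.1 this).resolve_left hne
  choose y hy using key
  have hxmono : ∀ j, j ≤ k → ∀ i, i ≤ j → x i ≤ x j := by
    intro j
    induction j with
    | zero => intro _ i hi; obtain rfl : i = 0 := by omega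
              exact le_rfl
    | succ j ih =>
      intro hj i hi
      rcases Nat.lt_or_ge i (j + 1) with h | h
      · exact (ih (by omega) i (by omega)).trans (h1 j (by omega)).le
      · obtain rfl : i = j + 1 := by omega
        exact le_rfl
  have hymono : ∀ i j, i < j → j < k → y i < y j := by
    intro i j hij hj
    exact ((hy i (by omega)).2.1.trans_le (hxmono j hj.le (i + 1) hij)).trans (hy j hj).1
  have hsub : (Finset.range k).image y ⊆ Q.roots.toFinset := by
    intro z hz
    obtain ⟨i, hi, rfl⟩ := Finset.mem_image.1 hz
    rw [Multiset.mem_toFinset, mem_roots hQ]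
    exact (hy i (Finset.mem_range.1 hi)).2.2
  have hcard : ((Finset.range k).image y).card = k := by
    rw [Finset.card_image_of_injOn, Finset.card_range]
    intro i hi j hj hij
    have hi' : i < k := by simpa using hi
    have hj' : j < k := by simpa using hj
    rcases lt_trichotomy i j with h | h | h
    · exact absurd hij (hymono i j h hj').ne
    · exact h
    · exact absurd hij (hymono j i h hi').ne'
  calc k = ((Finset.range k).image y).card := hcard.symm
    _ ≤ Q.roots.toFinset.card := Finset.card_le_card hsub
    _ ≤ Q.roots.card := Multiset.toFinset_card_le _

theorem gauss_decay_right (P : ℝ[X]) (r t : ℝ) (ht : 0 < t) (d : ℝ) (hd : 0 < d) (x0 : ℝ) :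
    ∃ z, x0 < z ∧ |P.eval z * Real.exp (-(t * (z - r) ^ 2))| < d := by
  have h1 := Polynomial.tendsto_div_exp_atTop P
  have h2 : ∀ᶠ x in Filter.atTop, |P.eval x / Real.exp x| < d := by
    have := h1.abs
    rw [abs_zero] at this
    exact this.eventually (gt_mem_nhds hd)
  have h3 : ∀ᶠ x : ℝ in Filter.atTop, x0 < x := Filter.eventually_gt_atTop x0
  have h4 : ∀ᶠ x : ℝ in Filter.atTop, |r| + 1 + (|r| + 2) / t < x := Filter.eventually_gt_atTop _
  obtain ⟨z, hz2, hz3, hz4⟩ := (h2.and (h3.and h4)).exists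
  refine ⟨z, hz3, lt_of_le_of_lt ?_ hz2⟩
  rw [div_eq_mul_inv, ← Real.exp_neg, abs_mul, abs_mul, Real.abs_exp, Real.abs_exp]
  refine mul_le_mul_of_nonneg_left (Real.exp_le_exp.2 ?_) (abs_nonneg _)
  have hr := le_abs_self r
  have hr0 := abs_nonneg r
  have hpos : 0 < (|r| + 2) / t := by positivity
  have hm : |r| + 2 = t * ((|r| + 2) / t) := by field_simp
  set w := (|r| + 2) / t
  have e1 : 1 + w < z - r := by linarith
  have e2 : |r| + 2 ≤ t * (z - r) := by
    rw [hm]; apply mul_le_mul_of_nonneg_left _ ht.le; linarith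
  have : z ≤ t * (z - r) ^ 2 := by
    have : (|r| + 2) * (z - r) ≤ t * (z - r) * (z - r) :=
      mul_le_mul_of_nonneg_right e2 (by linarith)
    nlinarith
  linarith

theorem gauss_decay_left (P : ℝ[X]) (r t : ℝ) (ht : 0 < t) (d : ℝ) (hd : 0 < d) (x0 : ℝ) :
    ∃ z, z < x0 ∧ |P.eval z * Real.exp (-(t * (z - r) ^ 2))| < d := by
  obtain ⟨z, h1, h2⟩ := gauss_decay_right (P.comp (-X)) (-r) t ht d hd (-x0)
  refine ⟨-z, by linarith, ?_⟩
  have : (z - -r) ^ 2 = (-z - r) ^ 2 := by ring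
  rw [this] at h2
  simpa using h2

theorem Alt.step {Q : ℝ[X]} {k : ℕ} (h : Alt Q k) (r t : ℝ) (ht : 0 < t) :
    Alt ((X - C r) * Q - C (2 * t) * derivative Q) (k + 1) := by
  obtain ⟨x, e, h1, h2⟩ := h
  set s : ℝ := 1 / (4 * t) with hs
  have hs0 : 0 < s := by positivity
  set g : ℝ → ℝ := fun z => Q.eval z * Real.exp (-(s * (z - r) ^ 2)) with hg
  have hg2 : ∀ i ≤ k, 0 < e * (-1) ^ i * g (x i) := by
    intro i hi
    have := mul_pos (h2 i hi) (Real.exp_pos (-(s * (x i - r) ^ 2)))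
    simp only [hg]; linarith
  have he : e ≠ 0 := by
    rintro rfl
    simpa using h2 0 (Nat.zero_le _)
  have hd : ∀ z, HasDerivAt g (-(1 / (2 * t)) *
      (((X - C r) * Q - C (2 * t) * derivative Q).eval z * Real.exp (-(s * (z - r) ^ 2)))) z := by
    intro z
    have a1 : HasDerivAt (fun z : ℝ => -(s * (z - r) ^ 2)) (-(s * (2 * (z - r)))) z := by
      have := ((((hasDerivAt_id z).sub_const r).pow 2).const_mul s).neg
      refine this.congr_deriv ?_
      simp
    have a2 := (Q.hasDerivAt z).mul a1.exp
    refine a2.congr_deriv ?_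
    simp only [eval_sub, eval_mul, eval_X, eval_C, hs]
    field_simp
    ring
  -- extended sequence
  have hsmall : ∀ z i, i ≤ k → |g z| < |g (x i)| → 0 < e * (-1) ^ i * (g (x i) - g z) := by
    intro z i hi hz
    have p := hg2 i hi
    have : |e * (-1) ^ i * g z| < |e * (-1) ^ i * g (x i)| := by
      rw [abs_mul, abs_mul (e * (-1) ^ i)]
      exact mul_lt_mul_of_pos_left hz (by simp [abs_mul, he])
    rw [abs_of_pos p] at this
    have := (abs_lt.1 this).2
    linarith
  have hgne : ∀ i ≤ k, 0 < |g (x i)| := by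
    intro i hi
    rw [abs_pos]
    intro h0
    have := hg2 i hi
    rw [h0] at this
    simp at this
  obtain ⟨zl, hzl, hzl'⟩ := gauss_decay_left Q r s hs0 _ (hgne 0 (Nat.zero_le _)) (x 0)
  obtain ⟨zr, hzr, hzr'⟩ := gauss_decay_right Q r s hs0 _ (hgne k le_rfl) (x k)
  let z : ℕ → ℝ := fun i => if i = 0 then zl else if i = k + 2 then zr else x (i - 1)
  have hz : ∀ i ≤ k + 1, z i < z (i + 1) ∧ 0 < e * (-1) ^ i * (g (z (i + 1)) - g (z i)) := by
    intro i hi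
    rcases Nat.eq_zero_or_pos i with rfl | hpos
    · have q1 : z 0 = zl := by simp [z]
      have q2 : z (0 + 1) = x 0 := by simp [z]
      rw [q1, q2]
      exact ⟨hzl, hsmall _ 0 (Nat.zero_le _) hzl'⟩
    · obtain ⟨j, rfl⟩ : ∃ j, i = j + 1 := ⟨i - 1, by omega⟩
      have q1 : z (j + 1) = x j := by
        have : j + 1 ≠ k + 2 := by omega
        simp [z]; omega
      rw [q1]
      by_cases hj : j = k
      · subst hj
        have q2 : z (j + 1 + 1) = zr := by simp [z]
        rw [q2]
        refine ⟨hzr, ?_⟩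
        have := hsmall _ j le_rfl hzr'
        rw [pow_succ]; linarith
      · have q2 : z (j + 1 + 1) = x (j + 1) := by
          simp [z]; omega
        rw [q2]
        refine ⟨h1 j (by omega), ?_⟩
        have p1 := hg2 j (by omega)
        have p2 := hg2 (j + 1) (by omega)
        rw [pow_succ] at *
        linarith
  have key : ∀ i, ∃ y, i ≤ k + 1 → z i < y ∧ y < z (i + 1) ∧
      0 < (-e) * (-1) ^ i * ((X - C r) * Q - C (2 * t) * derivative Q).eval y := by
    intro i
    by_cases hi : i ≤ k + 1
    swap
    · exact ⟨0, fun h => absurd h hi⟩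
    obtain ⟨l1, l2⟩ := hz i hi
    obtain ⟨y, hy, hy'⟩ := exists_hasDerivAt_eq_slope g _ l1
      (fun w _ => (hd w).continuousAt.continuousWithinAt) (fun w _ => hd w)
    refine ⟨y, fun _ => ⟨hy.1, hy.2, ?_⟩⟩
    have l3 : 0 < z (i + 1) - z i := by linarith
    have l4 := div_pos l2 l3
    rw [mul_div_assoc, ← hy'] at l4
    have l5 := Real.exp_pos (-(s * (y - r) ^ 2))
    have l6 : 0 < 1 / (2 * t) := by positivity
    set V := ((X - C r) * Q - C (2 * t) * derivative Q).eval y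
    set E := Real.exp (-(s * (y - r) ^ 2))
    set U := 1 / (2 * t)
    have : 0 < (-e * (-1) ^ i * V) * (U * E) := by
      calc 0 < _ := l4
        _ = _ := by ring
    exact pos_of_mul_pos_left this (mul_pos l6 l5).le
  choose y hy using key
  refine ⟨y, -e, ?_, ?_⟩
  · intro i hi
    exact (hy i (by omega)).2.1.trans (hy (i + 1) (by omega)).1
  · intro i hi
    exact (hy i hi).2.2

theorem heat_alt_prod (t : ℝ) (ht : 0 < t) (R : ℝ[X]) (hR : R ≠ 0) (m : Multiset ℝ) :
    Alt (heat (-t) ((m.map fun a => X - C a).prod * R)) m.card := by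
  induction m using Multiset.induction_on with
  | empty => simpa using alt_zero (heat_ne_zero (-t) hR)
  | cons a m ih =>
    have := ih.step a t ht
    rw [Multiset.card_cons, Multiset.map_cons, Multiset.prod_cons, mul_assoc, sub_mul, map_sub,
      heat_X_mul, heat_C_mul]
    convert this using 1
    have : (C (2 * -t) : ℝ[X]) = - C (2 * t) := by rw [← C_neg]; congr 1; ring
    rw [this]; ring

theorem heat_alt (t : ℝ) (ht : 0 < t) (P : ℝ[X]) (hP : P ≠ 0) :
    Alt (heat (-t) P) P.roots.card := by
  obtain ⟨q, hq, -, -⟩ := Polynomial.exists_prod_multiset_X_sub_C_mul P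
  have hq0 : q ≠ 0 := by
    rintro rfl
    rw [mul_zero] at hq
    exact hP hq.symm
  have := heat_alt_prod t ht q hq0 P.roots
  rwa [hq] at this

/-- Score predicate: at time `s` at least `n` real zeros, those in `W` lying over `S`. -/
def Score (P : ℝ[X]) (n : ℕ) (S : Finset (ℝ × ℝ)) (s : ℝ) : Prop :=
  ∃ (W Q : ℝ[X]) (k : ℕ), heat s P = W * Q ∧ W ≠ 0 ∧ Alt Q k ∧ n ≤ W.roots.card + k ∧
    ∀ a, W.eval a = 0 → (a, s) ∈ S

theorem Score.roots {P : ℝ[X]} {n : ℕ} {S : Finset (ℝ × ℝ)} {s : ℝ} (h : Score P n S s) :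
    n ≤ (heat s P).roots.card := by
  obtain ⟨W, Q, k, h1, h2, h3, h4, -⟩ := h
  rw [h1, roots_mul (mul_ne_zero h2 h3.ne_zero), Multiset.card_add]
  have := h3.card_roots
  omega

theorem Score.move {P : ℝ[X]} (hP : P ≠ 0) {n : ℕ} {S : Finset (ℝ × ℝ)} {s s' : ℝ}
    (h : Score P n S s) (hs : s' ≤ s) : Score P n S s' := by
  rcases hs.eq_or_lt with rfl | hlt
  · exact h
  have a1 := heat_alt (s - s') (by linarith) (heat s P) (heat_ne_zero s hP)
  rw [heat_heat] at a1
  have e : s + -(s - s') = s' := by ring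
  rw [e] at a1
  exact ⟨1, heat s' P, n, by simp, one_ne_zero, a1.mono h.roots, by simp, by simp⟩

theorem Score.add {P : ℝ[X]} {n : ℕ} {S : Finset (ℝ × ℝ)} {a s : ℝ}
    (h : Score P n S s) (ha : (a, s) ∉ S) (hd : (X - C a) ^ 2 ∣ heat s P) :
    Score P (n + 2) (insert (a, s) S) s := by
  obtain ⟨W, Q, k, h1, h2, h3, h4, h5⟩ := h
  have hW : W.eval a ≠ 0 := fun h0 => ha (h5 a h0)
  have hcop : IsCoprime ((X - C a) ^ 2) W := by
    apply IsCoprime.pow_left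
    rw [(prime_X_sub_C a).irreducible.coprime_iff_not_dvd, dvd_iff_isRoot]
    exact hW
  rw [h1] at hd
  obtain ⟨R, rfl⟩ := hcop.dvd_of_dvd_mul_left hd
  have hne : (X - C a) ^ 2 ≠ 0 := pow_ne_zero _ (X_sub_C_ne_zero a)
  refine ⟨W * (X - C a) ^ 2, R, k, by rw [h1]; ring, mul_ne_zero h2 hne, ?_, ?_, ?_⟩
  · obtain ⟨x, e, g1, g2⟩ := h3
    refine ⟨x, e, g1, fun i hi => ?_⟩
    have := g2 i hi
    rw [eval_mul, eval_pow, eval_sub, eval_X, eval_C] at this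
    have : 0 < (e * (-1) ^ i * R.eval (x i)) * (x i - a) ^ 2 := by linarith
    exact pos_of_mul_pos_left this (sq_nonneg _)
  · rw [roots_mul (mul_ne_zero h2 hne), roots_pow, roots_X_sub_C]
    simp; omega
  · intro b hb
    rw [eval_mul, mul_eq_zero] at hb
    rcases hb with hb | hb
    · exact Finset.mem_insert_of_mem (h5 b hb)
    · have : b = a := by simpa [sub_eq_zero] using hb
      rw [this]; exact Finset.mem_insert_self _ _

theorem score_all (P : ℝ[X]) (hP : P ≠ 0) (p0 : ℝ × ℝ) (h0 : (heat p0.2 P).eval p0.1 = 0)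
    (T : Finset (ℝ × ℝ)) : p0 ∉ T → (∀ p ∈ T, p.2 ≤ p0.2) →
    (∀ p ∈ T, (X - C p.1) ^ 2 ∣ heat p.2 P) →
    ∀ s, s ≤ p0.2 → (∀ p ∈ T, s ≤ p.2) → Score P (2 * T.card + 1) (insert p0 T) s := by
  classical
  induction T using Finset.induction_on_min_value (fun p : ℝ × ℝ => p.2) with
  | empty =>
    intro _ _ _ s hs _
    have : Score P 1 {p0} p0.2 := by
      obtain ⟨q, hq⟩ := dvd_iff_isRoot.2 h0
      refine ⟨X - C p0.1, q, 0, hq, X_sub_C_ne_zero _, alt_zero ?_, by simp, ?_⟩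
      · rintro rfl
        rw [mul_zero] at hq
        exact heat_ne_zero _ hP hq
      · intro a ha
        have : a = p0.1 := by simpa [sub_eq_zero] using ha
        rw [this]; simp
    simpa using this.move hP hs
  | insert p T hpT hmin ih =>
    intro g1 g2 g3 s hs hs'
    have a1 := ih (fun h => g1 (Finset.mem_insert_of_mem h))
      (fun q hq => g2 q (Finset.mem_insert_of_mem hq))
      (fun q hq => g3 q (Finset.mem_insert_of_mem hq)) p.2 (g2 p (Finset.mem_insert_self _ _)) hmin
    have a2 : Score P (2 * T.card + 1 + 2) (insert (p.1, p.2) (insert p0 T)) p.2 := by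
      apply a1.add
      · intro h
        rcases Finset.mem_insert.1 h with h | h
        · apply g1; rw [← h]; exact Finset.mem_insert_self _ _
        · exact hpT h
      · exact g3 p (Finset.mem_insert_self _ _)
    have a3 := a2.move hP (hs' p (Finset.mem_insert_self _ _))
    rw [Finset.card_insert_of_notMem hpT, Finset.insert_comm]
    convert a3 using 1
    ring

theorem sq_dvd_of_eval {P : ℝ[X]} (hP : P ≠ 0) {a : ℝ} (h : P.eval a = 0)
    (h' : (derivative P).eval a = 0) : (X - C a) ^ 2 ∣ P := by
  rw [← le_rootMultiplicity_iff hP]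
  exact (one_lt_rootMultiplicity_iff_isRoot hP).2 ⟨h, h'⟩

theorem exists_double (T : Finset (ℝ × ℝ)) :
    ∃ P : ℝ[X], P ≠ 0 ∧ P.natDegree ≤ 2 * T.card ∧ ∀ p ∈ T, (X - C p.1) ^ 2 ∣ heat p.2 P := by
  let L : degreeLT ℝ (2 * T.card + 1) →ₗ[ℝ] (T → ℝ × ℝ) :=
    LinearMap.pi fun p =>
      ((leval p.1.1 ∘ₗ heat p.1.2).prod (leval p.1.1 ∘ₗ derivative ∘ₗ heat p.1.2)) ∘ₗ
        (degreeLT ℝ (2 * T.card + 1)).subtype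
  have hfin : FiniteDimensional ℝ (degreeLT ℝ (2 * T.card + 1)) :=
    Module.Finite.equiv (degreeLTEquiv ℝ (2 * T.card + 1)).symm
  have hker : LinearMap.ker L ≠ ⊥ := by
    apply LinearMap.ker_ne_bot_of_finrank_lt
    rw [(degreeLTEquiv ℝ (2 * T.card + 1)).finrank_eq]
    simp [Module.finrank_pi_fintype]
    omega
  obtain ⟨v, hv, hv0⟩ := Submodule.exists_mem_ne_zero_of_ne_bot hker
  have hne : (v : ℝ[X]) ≠ 0 := by simpa using hv0
  refine ⟨v, hne, ?_, ?_⟩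
  · have := mem_degreeLT.1 v.2
    rw [← natDegree_lt_iff_degree_lt hne] at this
    omega
  · intro p hp
    have := congrFun (LinearMap.mem_ker.1 hv) ⟨p, hp⟩
    have h12 := Prod.ext_iff.1 this
    exact sq_dvd_of_eval (heat_ne_zero _ hne) h12.1 h12.2

theorem weights_zero (S : Finset (ℝ × ℝ)) (hS : S.card ≤ 4) (w : ℝ × ℝ → ℝ)
    (hw : ∀ p ∈ S, w p ≠ 0)
    (h : ∀ P : ℝ[X], P.natDegree ≤ 6 → ∑ p ∈ S, w p * (heat p.2 P).eval p.1 = 0) : S = ∅ := by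
  classical
  by_contra hne
  obtain ⟨p0, hp0, hmax⟩ := S.exists_max_image (fun p => p.2) (Finset.nonempty_iff_ne_empty.2 hne)
  have hc : (S.erase p0).card + 1 = S.card := Finset.card_erase_add_one hp0
  obtain ⟨P, hP, hdeg, hdvd⟩ := exists_double (S.erase p0)
  have hnz : (heat p0.2 P).eval p0.1 ≠ 0 := by
    intro h0
    obtain ⟨pm, hpm, hmin⟩ := S.exists_min_image (fun p => p.2) ⟨p0, hp0⟩
    have a1 := score_all P hP p0 h0 (S.erase p0) (Finset.notMem_erase _ _)
      (fun p hp => hmax p (Finset.mem_of_mem_erase hp)) hdvd pm.2 (hmin p0 hp0)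
      (fun p hp => hmin p (Finset.mem_of_mem_erase hp))
    have a2 := a1.roots
    have a3 := (heat pm.2 P).card_roots'
    have a4 := heat_natDegree pm.2 _ P hdeg
    omega
  replace hdeg : P.natDegree ≤ 6 := by omega
  have := h P hdeg
  rw [← Finset.add_sum_erase _ _ hp0, Finset.sum_eq_zero, add_zero] at this
  · exact (mul_ne_zero (hw p0 hp0) hnz) this
  · intro p hp
    obtain ⟨q, hq⟩ := hdvd p hp
    rw [hq]; simp

end heatLemmas

section systemLemmas
open Polynomial

theorem mIdxBox_zero {d : ℕ} : mIdxBox (0 : Fin d → ℕ) = {0} := by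
  ext x
  simp [mIdxBox, funext_iff]

theorem mpow_zero_right {d : ℕ} (v : Fin d → ℝ) : mpow v 0 = 1 := by simp [mpow]

theorem mfact_zero {d : ℕ} : mfact (0 : Fin d → ℕ) = 1 := by simp [mfact]

theorem mdeg_zero {d : ℕ} : mdeg (0 : Fin d → ℕ) = 0 := by simp [mdeg]

theorem mpow_zero_left {d : ℕ} {α : Fin d → ℕ} (h : α ≠ 0) : mpow (0 : Fin d → ℝ) α = 0 := by
  obtain ⟨j, hj⟩ := Function.ne_iff.1 h
  exact Finset.prod_eq_zero (Finset.mem_univ j) (by simpa using hj)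

/-- The univariate coefficient. -/
def hcoef (n : ℕ) (a b : ℝ) : ℝ :=
  ∑ α4 ∈ Finset.range (n + 1), ∑ α5 ∈ Finset.range (n + 1),
    if α4 + 2 * α5 = n then
      1 / ((Nat.factorial α4 : ℝ) * (Nat.factorial α5 : ℝ)) * a ^ α4 * b ^ α5 else 0

theorem ssLHS_zero {m d : ℕ} (p : Fin m → ℝ) (q1 : Fin m → Fin d → ℝ) (q2 : Fin d → ℝ)
    (q3 : Fin m → Fin d → ℝ) (q4 q5 : Fin m → ℝ) (n : ℕ) :
    ssLHS p q1 q2 q3 q4 q5 0 n = ∑ i, p i ^ 2 * hcoef n (q4 i) (q5 i) := by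
  unfold ssLHS hcoef
  refine Finset.sum_congr rfl fun i _ => ?_
  simp only [mIdxBox_zero, Finset.sum_singleton, mpow_zero_right, mfact_zero, mdeg_zero,
    Finset.mul_sum]
  refine Finset.sum_congr rfl fun x _ => Finset.sum_congr rfl fun y _ => ?_
  simp only [add_zero, zero_add, true_and, mul_ite, mul_zero]
  split_ifs
  · simp; ring
  · rfl

theorem hcoef_1 (a b : ℝ) : hcoef 1 a b = a := by
  simp [hcoef, Finset.sum_range_succ, Nat.factorial]
theorem hcoef_2 (a b : ℝ) : hcoef 2 a b = a ^ 2 / 2 + b := by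
  simp [hcoef, Finset.sum_range_succ, Nat.factorial]; ring
theorem hcoef_3 (a b : ℝ) : hcoef 3 a b = a ^ 3 / 6 + a * b := by
  simp [hcoef, Finset.sum_range_succ, Nat.factorial]; ring
theorem hcoef_4 (a b : ℝ) : hcoef 4 a b = a ^ 4 / 24 + a ^ 2 * b / 2 + b ^ 2 / 2 := by
  simp [hcoef, Finset.sum_range_succ, Nat.factorial]; ring
theorem hcoef_5 (a b : ℝ) : hcoef 5 a b = a ^ 5 / 120 + a ^ 3 * b / 6 + a * b ^ 2 / 2 := by
  simp [hcoef, Finset.sum_range_succ, Nat.factorial]; ring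
theorem hcoef_6 (a b : ℝ) : hcoef 6 a b =
    a ^ 6 / 720 + a ^ 4 * b / 24 + a ^ 2 * b ^ 2 / 4 + b ^ 3 / 6 := by
  simp [hcoef, Finset.sum_range_succ, Nat.factorial]; ring

theorem heat_pow_succ (b : ℝ) (n : ℕ) : heat b (X ^ (n + 1)) =
    X * heat b (X ^ n) + C (2 * b) * derivative (heat b (X ^ n)) := by
  rw [pow_succ', heat_X_mul]

theorem heat_pow_succ_eval (b a : ℝ) (n : ℕ) : (heat b (X ^ (n + 2))).eval a =
    a * (heat b (X ^ (n + 1))).eval a + 2 * b * ((n + 1) * (heat b (X ^ n)).eval a) := by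
  rw [heat_pow_succ, ← heat_derivative, derivative_X_pow, heat_C_mul]
  simp

theorem heat_eval_hcoef (a b : ℝ) (n : ℕ) (h1 : 1 ≤ n) (h6 : n ≤ 6) :
    (heat b (X ^ n)).eval a = (Nat.factorial n : ℝ) * hcoef n a b := by
  have e0 : (heat b (X ^ 0)).eval a = 1 := by simp [heat_one]
  have e1 : (heat b (X ^ 1)).eval a = a := by
    rw [show (1 : ℕ) = 0 + 1 from rfl, heat_pow_succ]; simp [heat_one]
  have e2 := heat_pow_succ_eval b a 0
  have e3 := heat_pow_succ_eval b a 1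
  have e4 := heat_pow_succ_eval b a 2
  have e5 := heat_pow_succ_eval b a 3
  have e6 := heat_pow_succ_eval b a 4
  norm_num only [Nat.cast_ofNat, Nat.cast_zero, Nat.cast_one] at e2 e3 e4 e5 e6

  rw [e0, e1] at e2
  rw [e1, e2] at e3
  rw [e2, e3] at e4
  rw [e3, e4] at e5
  rw [e4, e5] at e6
  interval_cases n
  · rw [e1, hcoef_1]; simp
  · rw [e2, hcoef_2]; norm_num [Nat.factorial]; ring
  · rw [e3, hcoef_3]; norm_num [Nat.factorial]; ring
  · rw [e4, hcoef_4]; norm_num [Nat.factorial]; ring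
  · rw [e5, hcoef_5]; norm_num [Nat.factorial]; ring
  · rw [e6, hcoef_6]; norm_num [Nat.factorial]; ring

theorem no_nontrivial_six (d : ℕ) : ¬ ssHasNontrivial 3 d 6 := by
  classical
  rintro ⟨p, q1, q2, q3, q4, q5, hp, ⟨i0, hi0⟩, h⟩
  have hE : ∀ n, 1 ≤ n → n ≤ 6 → ∑ i, p i ^ 2 * hcoef n (q4 i) (q5 i) = 0 := by
    intro n h1 h6
    have := h 0 n (by rw [mdeg_zero]; omega) (by rw [mdeg_zero]; omega)
    rwa [ssLHS_zero] at this
  let pt : Fin 3 → ℝ × ℝ := fun i => (q4 i, q5 i)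
  have hmom : ∀ P : ℝ[X], P.natDegree ≤ 6 →
      ∑ i, p i ^ 2 * (heat (q5 i) P).eval (q4 i) = (∑ i, p i ^ 2) * (heat 0 P).eval 0 := by
    intro P hP
    have hrep : P = ∑ k ∈ Finset.range 7, C (P.coeff k) * X ^ k :=
      P.as_sum_range_C_mul_X_pow' (by omega)
    have hmono : ∀ k ∈ Finset.range 7, ∑ i, p i ^ 2 * (heat (q5 i) (X ^ k)).eval (q4 i) =
        (∑ i, p i ^ 2) * (heat 0 (X ^ k)).eval 0 := by
      intro k hk
      have hk7 := Finset.mem_range.1 hk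
      rw [heat_zero]
      rcases Nat.eq_zero_or_pos k with rfl | hpos
      · simp [heat_one]
      · rw [eval_pow, eval_X, zero_pow (by omega), mul_zero]
        calc _ = ∑ i, (Nat.factorial k : ℝ) * (p i ^ 2 * hcoef k (q4 i) (q5 i)) := by
              refine Finset.sum_congr rfl fun i _ => ?_
              rw [heat_eval_hcoef _ _ k hpos (by omega)]; ring
          _ = 0 := by rw [← Finset.mul_sum, hE k hpos (by omega), mul_zero]
    rw [hrep]
    simp only [map_sum, heat_C_mul, eval_finsetSum, eval_mul, eval_C, Finset.mul_sum]
    rw [Finset.sum_comm]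
    refine Finset.sum_congr rfl fun k hk => ?_
    calc _ = P.coeff k * ∑ i, p i ^ 2 * (heat (q5 i) (X ^ k)).eval (q4 i) := by
          rw [Finset.mul_sum]
          exact Finset.sum_congr rfl fun i _ => by ring
      _ = _ := by rw [hmono k hk]; ring
  let w : ℝ × ℝ → ℝ := fun z =>
    (∑ i, if pt i = z then p i ^ 2 else 0) - if (0, 0) = z then ∑ i, p i ^ 2 else 0
  let A : Finset (ℝ × ℝ) := insert (0, 0) (Finset.univ.image pt)
  have hA : A.card ≤ 4 := by
    refine (Finset.card_insert_le _ _).trans ?_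
    have := Finset.card_image_le (s := (Finset.univ : Finset (Fin 3))) (f := pt)
    simp at this
    omega
  have hptA : ∀ i, pt i ∈ A := fun i =>
    Finset.mem_insert_of_mem (Finset.mem_image_of_mem _ (Finset.mem_univ i))
  have h0A : ((0, 0) : ℝ × ℝ) ∈ A := Finset.mem_insert_self _ _
  have hempty := weights_zero (A.filter fun z => w z ≠ 0)
    ((Finset.card_filter_le _ _).trans hA) w (fun z hz => (Finset.mem_filter.1 hz).2) (by
      intro P hP
      have hs : ∑ z ∈ A.filter (fun z => w z ≠ 0), w z * (heat z.2 P).eval z.1 =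
          ∑ z ∈ A, w z * (heat z.2 P).eval z.1 := by
        apply Finset.sum_filter_of_ne
        intro z _ hz h0
        rw [h0, zero_mul] at hz
        exact hz rfl
      rw [hs]
      simp only [w, sub_mul, Finset.sum_mul, Finset.sum_sub_distrib, ite_mul, zero_mul]
      rw [Finset.sum_comm]
      simp only [Finset.sum_ite_eq, hptA, h0A, if_true]
      have := hmom P hP
      rw [Finset.sum_mul] at this
      exact sub_eq_zero.2 this)
  have hw0 : w (pt i0) = 0 := by
    by_contra hne
    have : pt i0 ∈ A.filter fun z => w z ≠ 0 := Finset.mem_filter.2 ⟨hptA i0, hne⟩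
    rw [hempty] at this
    simp at this
  have hne0 : ((0, 0) : ℝ × ℝ) ≠ pt i0 := by
    intro h
    exact hi0 (congrArg Prod.fst h).symm
  simp only [w, if_neg hne0, sub_zero] at hw0
  have hpos : 0 < ∑ i, if pt i = pt i0 then p i ^ 2 else 0 := by
    apply Finset.sum_pos'
    · intro i _
      split_ifs <;> positivity
    · exact ⟨i0, Finset.mem_univ _, by rw [if_pos rfl]; have := hp i0; positivity⟩
  exact hpos.ne' hw0

theorem nontrivial_five (d r : ℕ) (hr : r < 6) : ssHasNontrivial 3 d r := by
  refine ⟨![Real.sqrt (1 / 2), Real.sqrt (1 / 2), Real.sqrt (3 / 5)], 0, 0, 0, ![1, -1, 0],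
    ![-1 / 4, -1 / 4, -5 / 12], ?_, ⟨0, by simp⟩, ?_⟩
  · intro i
    fin_cases i <;> simp
  intro ρ1 ρ2 h1 h2
  by_cases hρ : ρ1 = 0
  · subst hρ
    rw [mdeg_zero, zero_add] at h1 h2
    rw [ssLHS_zero, Fin.sum_univ_three]
    have s1 : Real.sqrt (1 / 2) ^ 2 = 1 / 2 := Real.sq_sqrt (by norm_num)
    have s2 : Real.sqrt (3 / 5) ^ 2 = 3 / 5 := Real.sq_sqrt (by norm_num)
    simp only [Matrix.cons_val_zero, Matrix.cons_val_one, Matrix.cons_val, s1, s2]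
    have : ρ2 ≤ 5 := by omega
    interval_cases ρ2
    · simp only [hcoef_1]; norm_num
    · simp only [hcoef_2]; norm_num
    · simp only [hcoef_3]; norm_num
    · simp only [hcoef_4]; norm_num
    · simp only [hcoef_5]; norm_num
  · unfold ssLHS
    refine Finset.sum_eq_zero fun i _ => Finset.sum_eq_zero fun α1 _ =>
      Finset.sum_eq_zero fun α2 _ => Finset.sum_eq_zero fun α3 _ =>
      Finset.sum_eq_zero fun α4 _ => Finset.sum_eq_zero fun α5 _ => ?_
    split_ifs with hc
    · by_cases g1 : α1 = 0
      · by_cases g2 : α2 = 0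
        · have g3 : α3 ≠ 0 := by
            rintro rfl
            apply hρ
            rw [← hc.1, g1, g2]; simp
          simp only [Pi.zero_apply, mpow_zero_left g3]; ring
        · simp only [mpow_zero_left g2]; ring
      · simp only [Pi.zero_apply, mpow_zero_left g1]; ring
    · rfl

end systemLemmas

/-- `r^SS(3) = 6` for every `d ≥ 1`: `6` is the least `r` for which the
Softmax–Softmax system of order `r` with `m = 3` blocks has no non-trivial solution. -/
theorem rSS_three_eq_six (d : ℕ) (hd : 1 ≤ d) :
    IsLeast {r : ℕ | ¬ ssHasNontrivial 3 d r} 6 := by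
  refine ⟨no_nontrivial_six d, ?_⟩
  intro r hr
  by_contra hlt
  exact hr (nontrivial_five d r (by omega))
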